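/- Let X be a nonempty compact metric space and T : X → X a continuous map. Define the ergodic attractor E := ⋃ { supp μ : μ a T-invariant Borel probability measure on X } and the ω-limit set on average ω̄(u) := { v ∈ X : for every open neighbourhood U of v, limsup_{n→∞} (1/n) ∑_{k=0}^{n-1} 1_U(T^k u) > 0 }. Then the closure of E equals the closure of ⋃_{u ∈ X} ω̄(u); in particular, since E is closed, E = Cl( ⋃_{u ∈ X} ω̄(u) ). -/

import Mathlib

open MeasureTheory Filter

/-- The support of a Borel measure: the set of points all of whose open
neighbourhoods have positive measure. -/
def measSupport {X : Type*} [TopologicalSpace X] [MeasurableSpace X]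
    (μ : Measure X) : Set X :=
  {x | ∀ U : Set X, IsOpen U → x ∈ U → 0 < μ U}

/-- The ω-limit set on average of a point `u` under the map `T`. -/
def avgOmegaLimit {X : Type*} [TopologicalSpace X] (T : X → X) (u : X) : Set X :=
  {v | ∀ U : Set X, IsOpen U → v ∈ U →
    0 < limsup (fun n : ℕ =>
      (1 / (n : ℝ)) * ∑ k ∈ Finset.range n, Set.indicator U (fun _ => (1 : ℝ)) (T^[k] u)) atTop}

open Topology Set

theorem measSupport_eq_support {X : Type*} [TopologicalSpace X] [MeasurableSpace X]
    (μ : Measure X) : measSupport μ = μ.support := by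
  ext x
  rw [(nhds_basis_opens x).mem_measureSupport]
  exact ⟨fun h U hU => h U hU.2 hU.1, fun h U hU hx => h U ⟨hx, hU⟩⟩

section BirkhoffAverage

variable {X : Type*} (T : X → X)

theorem birkhoffAverage_nonneg {f : X → ℝ} (hf : 0 ≤ f) (n : ℕ) (u : X) :
    0 ≤ birkhoffAverage ℝ T f n u :=
  smul_nonneg (by positivity) (Finset.sum_nonneg fun _ _ => hf _)

theorem birkhoffAverage_mono {f g : X → ℝ} (hfg : f ≤ g) (n : ℕ) (u : X) :
    birkhoffAverage ℝ T f n u ≤ birkhoffAverage ℝ T g n u :=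
  smul_le_smul_of_nonneg_left (Finset.sum_le_sum fun _ _ => hfg _) (by positivity)

theorem birkhoffAverage_le_one {f : X → ℝ} (hf : f ≤ 1) (n : ℕ) (u : X) :
    birkhoffAverage ℝ T f n u ≤ 1 := by
  refine (birkhoffAverage_mono T hf n u).trans ?_
  rcases eq_or_ne (n : ℝ) 0 with h | h <;> simp [birkhoffAverage, birkhoffSum, h]

theorem birkhoffAverage_indicator_nonneg (U : Set X) (n : ℕ) (u : X) :
    0 ≤ birkhoffAverage ℝ T (U.indicator fun _ => (1 : ℝ)) n u :=
  birkhoffAverage_nonneg T (fun _ => indicator_nonneg (fun _ _ => zero_le_one) _) n u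

theorem birkhoffAverage_indicator_le_one (U : Set X) (n : ℕ) (u : X) :
    birkhoffAverage ℝ T (U.indicator fun _ => (1 : ℝ)) n u ≤ 1 :=
  birkhoffAverage_le_one T (fun _ => indicator_le_self' (fun _ _ => zero_le_one) _) n u

theorem mem_avgOmegaLimit_iff [TopologicalSpace X] {u v : X} :
    v ∈ avgOmegaLimit T u ↔ ∀ U : Set X, IsOpen U → v ∈ U →
      0 < limsup (fun n => birkhoffAverage ℝ T (U.indicator fun _ => (1 : ℝ)) n u) atTop := by
  simp [avgOmegaLimit, birkhoffAverage, birkhoffSum]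

theorem tendsto_birkhoffAverage_indicator_of_limsup_nonpos {U : Set X} {u : X}
    (h : limsup (fun n => birkhoffAverage ℝ T (U.indicator fun _ => (1 : ℝ)) n u) atTop ≤ 0) :
    Tendsto (fun n => birkhoffAverage ℝ T (U.indicator fun _ => (1 : ℝ)) n u) atTop (𝓝 0) := by
  have hb : IsBoundedUnder (· ≤ ·) atTop
      (fun n => birkhoffAverage ℝ T (U.indicator fun _ => (1 : ℝ)) n u) :=
    isBoundedUnder_of ⟨1, fun n => birkhoffAverage_indicator_le_one T U n u⟩
  have hb' : IsBoundedUnder (· ≥ ·) atTop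
      (fun n => birkhoffAverage ℝ T (U.indicator fun _ => (1 : ℝ)) n u) :=
    isBoundedUnder_of ⟨0, fun n => birkhoffAverage_indicator_nonneg T U n u⟩
  refine tendsto_of_le_liminf_of_limsup_le ?_ h hb hb'
  exact le_liminf_of_le hb.isCoboundedUnder_ge
    (Eventually.of_forall fun n => birkhoffAverage_indicator_nonneg T U n u)

/-- If a compact set contains no point of the ω-limit set on average of `u`, then the orbit of `u`
visits it with frequency zero. -/
theorem tendsto_birkhoffAverage_indicator_of_disjoint [TopologicalSpace X] {C : Set X}
    (hC : IsCompact C) {u : X} (hd : Disjoint C (avgOmegaLimit T u)) :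
    Tendsto (fun n => birkhoffAverage ℝ T (C.indicator fun _ => (1 : ℝ)) n u) atTop (𝓝 0) := by
  refine hC.induction_on
    (p := fun s => Tendsto (fun n => birkhoffAverage ℝ T (s.indicator fun _ => (1 : ℝ)) n u)
      atTop (𝓝 0)) ?_ ?_ ?_ ?_
  · simp [birkhoffAverage, birkhoffSum]
  · intro s t hst ht
    exact squeeze_zero (fun n => birkhoffAverage_indicator_nonneg T s n u)
      (fun n => birkhoffAverage_mono T
        (indicator_le_indicator_of_subset hst fun _ => zero_le_one) n u) ht
  · intro s t hs ht
    have hst := hs.add ht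
    rw [add_zero] at hst
    refine squeeze_zero (fun n => birkhoffAverage_indicator_nonneg T _ n u) (fun n => ?_) hst
    rw [← Pi.add_apply, ← Pi.add_apply, ← birkhoffAverage_add]
    refine birkhoffAverage_mono T (fun x => ?_) n u
    by_cases h₁ : x ∈ s <;> by_cases h₂ : x ∈ t <;> simp [h₁, h₂]
  · intro x hx
    have hxu := disjoint_left.1 hd hx
    rw [mem_avgOmegaLimit_iff] at hxu
    push Not at hxu
    obtain ⟨U, hU, hxU, hlim⟩ := hxu
    exact ⟨U, mem_nhdsWithin_of_mem_nhds (hU.mem_nhds hxU),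
      tendsto_birkhoffAverage_indicator_of_limsup_nonpos T hlim⟩

theorem integral_birkhoffAverage [MeasurableSpace X] {T : X → X} {μ : Measure X}
    (hT : MeasurePreserving T μ μ) {f : X → ℝ} (hf : Integrable f μ) {n : ℕ} (hn : n ≠ 0) :
    ∫ x, birkhoffAverage ℝ T f n x ∂μ = ∫ x, f x ∂μ := by
  have hi (k : ℕ) : ∫ x, f (T^[k] x) ∂μ = ∫ x, f x ∂μ := by
    have hk := hT.iterate k
    have hfm : AEStronglyMeasurable f (μ.map T^[k]) := by
      rw [hk.map_eq]
      exact hf.aestronglyMeasurable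
    rw [← integral_map hk.measurable.aemeasurable hfm, hk.map_eq]
  simp only [birkhoffAverage, birkhoffSum, smul_eq_mul]
  rw [integral_const_mul, integral_finsetSum _ fun k _ =>
    show Integrable (fun x => f (T^[k] x)) μ from (hT.iterate k).integrable_comp_of_integrable hf]
  simp [hi, hn]

/-- A set charged by an invariant measure is visited with nonzero upper frequency by some orbit. -/
theorem exists_not_tendsto_birkhoffAverage_indicator [MeasurableSpace X] {T : X → X}
    {μ : Measure X} [IsFiniteMeasure μ] (hT : MeasurePreserving T μ μ) {C : Set X}
    (hC : MeasurableSet C) (hμ : 0 < μ C) :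
    ∃ u, ¬ Tendsto (fun n => birkhoffAverage ℝ T (C.indicator fun _ => (1 : ℝ)) n u)
      atTop (𝓝 0) := by
  by_contra! h
  have hmeas : Measurable (C.indicator fun _ => (1 : ℝ)) := measurable_const.indicator hC
  have hav (n : ℕ) : Measurable (birkhoffAverage ℝ T (C.indicator fun _ => (1 : ℝ)) n) :=
    (Finset.measurable_fun_sum (Finset.range n) fun k _ =>
      hmeas.comp (hT.measurable.iterate k)).const_smul (n : ℝ)⁻¹
  have hlim := tendsto_integral_of_dominated_convergence (μ := μ) (fun _ => (1 : ℝ))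
    (fun n => (hav n).aestronglyMeasurable)
    (integrable_const _)
    (fun n => Eventually.of_forall fun u => by
      rw [Real.norm_of_nonneg (birkhoffAverage_indicator_nonneg T C n u)]
      exact birkhoffAverage_indicator_le_one T C n u)
    (Eventually.of_forall h)
  have hconst : ∀ᶠ n in atTop,
      ∫ x, birkhoffAverage ℝ T (C.indicator fun _ => (1 : ℝ)) n x ∂μ = μ.real C := by
    filter_upwards [eventually_ne_atTop 0] with n hn
    rw [integral_birkhoffAverage hT ((integrable_const _).indicator hC) hn]
    exact integral_indicator_one hC
  have heq := tendsto_nhds_unique (tendsto_const_nhds.congr' (hconst.mono fun _ h => h.symm)) hlim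
  rw [integral_zero] at heq
  exact (ENNReal.toReal_pos hμ.ne' (measure_ne_top μ C)).ne' heq

end BirkhoffAverage

section EmpiricalMeasure

variable {X : Type*} [MeasurableSpace X]

/-- The empirical measure of the first `n + 1` points of the orbit of `u` under `T`. -/
noncomputable def empiricalMeasure (T : X → X) (u : X) (n : ℕ) : ProbabilityMeasure X :=
  ⟨((n + 1 : ℕ) : ENNReal)⁻¹ • ∑ k ∈ Finset.range (n + 1), Measure.dirac (T^[k] u), ⟨by
    simpa using ENNReal.inv_mul_cancel (by simp) (by finiteness)⟩⟩

theorem integral_empiricalMeasure (T : X → X) (u : X) (n : ℕ) {f : X → ℝ} (hf : Measurable f) :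
    ∫ x, f x ∂(empiricalMeasure T u n : Measure X) = birkhoffAverage ℝ T f (n + 1) u := by
  simp only [empiricalMeasure, ProbabilityMeasure.coe_mk, birkhoffAverage, birkhoffSum]
  rw [integral_smul_measure, integral_finsetSum_measure fun k _ =>
    (integrable_dirac' hf.stronglyMeasurable (by simp))]
  simp [integral_dirac' _ _ hf.stronglyMeasurable, -Nat.cast_add]

theorem empiricalMeasure_apply (T : X → X) (u : X) (n : ℕ) {C : Set X} (hC : MeasurableSet C) :
    (empiricalMeasure T u n : Measure X) C =
      ENNReal.ofReal (birkhoffAverage ℝ T (C.indicator fun _ => (1 : ℝ)) (n + 1) u) := by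
  rw [← integral_empiricalMeasure T u n (measurable_const.indicator hC)]
  exact ((congrArg ENNReal.ofReal (integral_indicator_one hC)).trans ofReal_measureReal).symm

/-- Every limit of empirical measures along a filter is invariant. -/
theorem map_eq_of_tendsto_empiricalMeasure [TopologicalSpace X] [BorelSpace X]
    [HasOuterApproxClosed X] {T : X → X} (hT : Continuous T) {u : X} {F : Filter ℕ} [F.NeBot]
    (hF : F ≤ atTop) {μ : ProbabilityMeasure X} (hμ : Tendsto (empiricalMeasure T u) F (𝓝 μ)) :
    (μ : Measure X).map T = μ := by
  have : IsProbabilityMeasure ((μ : Measure X).map T) :=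
    Measure.isProbabilityMeasure_map hT.measurable.aemeasurable
  refine ext_of_forall_integral_eq_of_IsFiniteMeasure fun f => ?_
  rw [integral_map hT.measurable.aemeasurable f.continuous.measurable.aestronglyMeasurable]
  have h := ProbabilityMeasure.tendsto_iff_forall_integral_tendsto.1 hμ
  have h₁ := h (f.compContinuous ⟨T, hT⟩)
  have h₂ := h f
  have h₃ := ((tendsto_birkhoffAverage_apply_sub_birkhoffAverage' ℝ f.isBounded_range T u).comp
    (tendsto_add_atTop_nat 1)).mono_left hF
  refine sub_eq_zero.1 (tendsto_nhds_unique ((h₁.sub h₂).congr fun n => ?_) h₃)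
  rw [integral_empiricalMeasure T u n (BoundedContinuousFunction.continuous _).measurable,
    integral_empiricalMeasure T u n f.continuous.measurable]
  refine congrArg (· - _) (congrArg (_ • ·) (Finset.sum_congr rfl fun k _ => congrArg f ?_))
  exact (Function.iterate_succ_apply' T k u).symm.trans (Function.iterate_succ_apply T k u)

/-- A closed set which an orbit visits with positive upper frequency is charged by an invariant
probability measure. -/
theorem exists_invariant_measure_pos_of_limsup_pos [TopologicalSpace X] [BorelSpace X]
    [CompactSpace X] [T2Space X] [HasOuterApproxClosed X]
    {T : X → X} (hT : Continuous T) {u : X} {C : Set X} (hC : IsClosed C)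
    (h : 0 < limsup (fun n => birkhoffAverage ℝ T (C.indicator fun _ => (1 : ℝ)) n u) atTop) :
    ∃ μ : ProbabilityMeasure X, (μ : Measure X).map T = μ ∧ 0 < (μ : Measure X) C := by
  rw [← limsup_nat_add _ 1] at h
  obtain ⟨c, hc, hcl⟩ := exists_between h
  have hfreq := frequently_lt_of_lt_limsup (IsBoundedUnder.isCoboundedUnder_le
    (isBoundedUnder_of ⟨0, fun n => birkhoffAverage_indicator_nonneg T C (n + 1) u⟩)) hcl
  have hne := frequently_iff_neBot.1 hfreq
  obtain ⟨F, hF⟩ := Ultrafilter.exists_le (atTop ⊓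
    𝓟 {n | c < birkhoffAverage ℝ T (C.indicator fun _ => (1 : ℝ)) (n + 1) u})
  have hlim : Tendsto (empiricalMeasure T u) F (𝓝 (F.map (empiricalMeasure T u)).lim) :=
    (F.map (empiricalMeasure T u)).le_nhds_lim
  refine ⟨_, map_eq_of_tendsto_empiricalMeasure hT (hF.trans inf_le_left) hlim, ?_⟩
  refine (ENNReal.ofReal_pos.2 hc).trans_le (le_trans ?_
    (ProbabilityMeasure.limsup_measure_closed_le_of_tendsto hlim hC))
  refine le_limsup_of_frequently_le (Eventually.frequently ?_)
  filter_upwards [hF (mem_inf_of_right (mem_principal_self _))] with n hn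
  rw [empiricalMeasure_apply T u n hC.measurableSet]
  exact ENNReal.ofReal_le_ofReal (le_of_lt hn)

end EmpiricalMeasure

/-- The ergodic attractor of `T`: the union of the supports of its invariant probability
measures. -/
def ergodicAttractor {X : Type*} [TopologicalSpace X] [MeasurableSpace X] (T : X → X) : Set X :=
  {x | ∃ μ : Measure X, IsProbabilityMeasure μ ∧
    (∀ A : Set X, MeasurableSet A → μ (T ⁻¹' A) = μ A) ∧ x ∈ measSupport μ}

theorem isClosed_ergodicAttractor {X : Type*} [TopologicalSpace X] [FrechetUrysohnSpace X]
    [MeasurableSpace X] {T : X → X} (hT : Measurable T) :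
    IsClosed (ergodicAttractor T) := by
  refine isClosed_of_closure_subset fun x hx => ?_
  obtain ⟨y, hy, hyx⟩ := mem_closure_iff_seq_limit.1 hx
  choose μ hμ hinv hsupp using hy
  have hsum : ∑' n : ℕ, (2 : ENNReal)⁻¹ ^ (n + 1) = 1 := by
    rw [ENNReal.tsum_geometric_add_one, ENNReal.one_sub_inv_two, inv_inv]
    exact ENNReal.inv_mul_cancel two_ne_zero ENNReal.ofNat_ne_top
  refine ⟨Measure.sum fun n => (2 : ENNReal)⁻¹ ^ (n + 1) • μ n, ⟨?_⟩, fun A hA => ?_,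
    fun U hU hxU => ?_⟩
  · simpa using hsum
  · simp [Measure.sum_apply _ (hT hA), Measure.sum_apply _ hA, hinv _ A hA]
  · obtain ⟨n, hn⟩ := (hyx.eventually (hU.mem_nhds hxU)).exists
    have hpos : 0 < ((2 : ENNReal)⁻¹ ^ (n + 1) • μ n) U := by
      simpa using ⟨ENNReal.pow_pos (by simp) _, hsupp n U hU hn⟩
    exact hpos.trans_le (Measure.le_sum _ n U)

theorem avgOmegaLimit_subset_ergodicAttractor {X : Type*} [MetricSpace X] [CompactSpace X]
    [MeasurableSpace X] [BorelSpace X] {T : X → X} (hT : Continuous T) (u : X) :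
    avgOmegaLimit T u ⊆ ergodicAttractor T := by
  intro v hv
  rw [mem_avgOmegaLimit_iff] at hv
  refine (isClosed_ergodicAttractor hT.measurable).closure_subset
    ((mem_closure_iff_nhds_basis Metric.nhds_basis_closedBall).2 fun r hr => ?_)
  have hpos : 0 < limsup (fun n => birkhoffAverage ℝ T
      ((Metric.closedBall v r).indicator fun _ => (1 : ℝ)) n u) atTop := by
    refine (hv _ Metric.isOpen_ball (Metric.mem_ball_self hr)).trans_le
      (limsup_le_limsup (Eventually.of_forall fun n => birkhoffAverage_mono T
        (indicator_le_indicator_of_subset Metric.ball_subset_closedBall fun _ => zero_le_one) n u)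
      (IsBoundedUnder.isCoboundedUnder_le
        (isBoundedUnder_of ⟨0, fun n => birkhoffAverage_indicator_nonneg T _ n u⟩))
      (isBoundedUnder_of ⟨1, fun n => birkhoffAverage_indicator_le_one T _ n u⟩))
  obtain ⟨μ, hinv, hμ⟩ :=
    exists_invariant_measure_pos_of_limsup_pos hT Metric.isClosed_closedBall hpos
  obtain ⟨y, hy, hys⟩ := Measure.nonempty_inter_support_of_pos hμ
  refine ⟨y, ⟨μ, inferInstance, fun A hA => ?_,
    (measSupport_eq_support (μ : Measure X)).symm ▸ hys⟩, hy⟩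
  rw [← Measure.map_apply hT.measurable hA, hinv]

theorem ergodicAttractor_subset_closure {X : Type*} [MetricSpace X] [CompactSpace X]
    [MeasurableSpace X] [BorelSpace X] {T : X → X} (hT : Measurable T) :
    ergodicAttractor T ⊆ closure (⋃ u, avgOmegaLimit T u) := by
  rintro x ⟨μ, hμ, hinv, hx⟩
  refine (mem_closure_iff_nhds_basis Metric.nhds_basis_closedBall).2 fun r hr => ?_
  have hpos : 0 < μ (Metric.closedBall x r) :=
    (hx _ Metric.isOpen_ball (Metric.mem_ball_self hr)).trans_le
      (measure_mono Metric.ball_subset_closedBall)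
  have hmp : MeasurePreserving T μ μ :=
    ⟨hT, Measure.ext fun A hA => by rw [Measure.map_apply hT hA, hinv A hA]⟩
  obtain ⟨u, hu⟩ := exists_not_tendsto_birkhoffAverage_indicator hmp
    Metric.isClosed_closedBall.measurableSet hpos
  obtain ⟨v, hv, hvu⟩ := not_disjoint_iff.1 fun hd => hu
    (tendsto_birkhoffAverage_indicator_of_disjoint T Metric.isClosed_closedBall.isCompact hd)
  exact ⟨v, mem_iUnion.2 ⟨u, hvu⟩, hv⟩

theorem stmt_11 {X : Type*} [MetricSpace X] [CompactSpace X] [Nonempty X]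
    [MeasurableSpace X] [BorelSpace X]
    (T : X → X) (hT : Continuous T)
    (E : Set X)
    (hE : E = {x : X | ∃ μ : Measure X, IsProbabilityMeasure μ ∧
      (∀ A : Set X, MeasurableSet A → μ (T ⁻¹' A) = μ A) ∧ x ∈ measSupport μ}) :
    closure E = closure (⋃ u : X, avgOmegaLimit T u) ∧
    E = closure (⋃ u : X, avgOmegaLimit T u) := by
  change E = ergodicAttractor T at hE
  have hclosed := isClosed_ergodicAttractor hT.measurable
  have h : E = closure (⋃ u : X, avgOmegaLimit T u) := by
    rw [hE]
    exact (ergodicAttractor_subset_closure hT.measurable).antisymm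
      (closure_minimal (iUnion_subset (avgOmegaLimit_subset_ergodicAttractor hT)) hclosed)
  exact ⟨by rw [h, closure_closure], h⟩
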